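/- Let G=(V,E,ρ) be a multi-valued regulatory graph and K ∈ K_G, and let Norm(G,K)=(G,N) be its normalization. Then every edge (u,n,v) ∈ E that is not observable in the transition system T_G(K) is not observable in the normalized parametrization N. -/

import Mathlib

/-!
Formalization of multi-valued regulatory graphs (Thomas networks),
their parametrizations, asynchronous transition systems,
canonization, completion, normalization and minimization.
-/

namespace MVReg

open Classical

/-- A multi-valued regulatory graph over components `V` with maximal
activity levels `ρ`: a finite set of regulations `(u, n, v)` with
threshold `0 < n ≤ ρ u`. -/
structure RegGraph (V : Type*) (ρ : V → ℕ) where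
  E : Finset (V × ℕ × V)
  valid : ∀ e ∈ E, 1 ≤ e.2.1 ∧ e.2.1 ≤ ρ e.1

/-- A (total) parametrization candidate: a value for each component and
each potential regulatory context (a context assigns to each regulator
an interval, represented by its pair of endpoints `[j, k)`). -/
abbrev Param (V : Type*) := V → (V → ℕ × ℕ) → ℕ

variable {V : Type*} [DecidableEq V] [Fintype V] {ρ : V → ℕ}

/-- The extended threshold set `Θ(u,v) = θ(u,v) ∪ {0, ρ u + 1}`. -/
def Theta (G : RegGraph V ρ) (u v : V) : Set ℕ :=
  {m | (u, m, v) ∈ G.E} ∪ {0, ρ u + 1}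

/-- Activity intervals `I_v^u`: pairs `(j,k)` (representing `[j,k)`) of
consecutive members of `Θ(u,v)`. -/
def ActInterval (G : RegGraph V ρ) (u v : V) : Set (ℕ × ℕ) :=
  {p | p.1 ∈ Theta G u v ∧ p.2 ∈ Theta G u v ∧ p.1 < p.2 ∧
    ∀ l ∈ Theta G u v, ¬ (p.1 < l ∧ l < p.2)}

/-- The regulatory contexts `Ω_v` of a component `v`. -/
def Context (G : RegGraph V ρ) (v : V) : Set (V → ℕ × ℕ) :=
  {ω | ∀ u, ω u ∈ ActInterval G u v}

/-- `K ∈ 𝒦_G` : on every regulatory context of `v` the value lies in `[0, ρ v]`. -/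
def IsParam (G : RegGraph V ρ) (K : Param V) : Prop :=
  ∀ v : V, ∀ ω ∈ Context G v, K v ω ≤ ρ v

/-- The state space `S = ∏_v [0, ρ v]`. -/
def States (ρ : V → ℕ) : Set (V → ℕ) := {s | ∀ v, s v ≤ ρ v}

/-- `s ∈ ω` : the state `s` lies in the context `ω`. -/
def memCtx (ω : V → ℕ × ℕ) (s : V → ℕ) : Prop :=
  ∀ u, (ω u).1 ≤ s u ∧ s u < (ω u).2

/-- The (unique) regulatory context of `v` containing the state `s`. -/
noncomputable def ctxOf (G : RegGraph V ρ) (v : V) (s : V → ℕ) : V → ℕ × ℕ :=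
  fun u => (sSup {m | m ∈ Theta G u v ∧ m ≤ s u}, sInf {m | m ∈ Theta G u v ∧ s u < m})

/-- The asynchronous update function `F^K_v`. -/
noncomputable def F (G : RegGraph V ρ) (K : Param V) (v : V) (s : V → ℕ) : ℕ :=
  if s v < K v (ctxOf G v s) then s v + 1
  else if s v = K v (ctxOf G v s) then s v
  else s v - 1

/-- The derivative `δ(F^K_v)(s) = F^K_v(s) − s_v` (as an integer). -/
noncomputable def delta (G : RegGraph V ρ) (K : Param V) (v : V) (s : V → ℕ) : ℤ :=
  (F G K v s : ℤ) - (s v : ℤ)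

/-- The asynchronous transition system `T_G(K)`, as the set of transitions. -/
noncomputable def TS (G : RegGraph V ρ) (K : Param V) : Set ((V → ℕ) × (V → ℕ)) :=
  {p | p.1 ∈ States ρ ∧ p.2 ∈ States ρ ∧ p.1 ≠ p.2 ∧
    ∃ v : V, p.2 = Function.update p.1 v (F G K v p.1)}

/-- The synchronous transition system of `(G, K)`. -/
noncomputable def SyncTS (G : RegGraph V ρ) (K : Param V) : Set ((V → ℕ) × (V → ℕ)) :=
  {p | p.1 ∈ States ρ ∧ p.2 ∈ States ρ ∧ ∀ v : V, p.2 v = F G K v p.1}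

/-- A parametrization is canonical iff `j − 1 ≤ K_v(ω) ≤ k` for every context with
`ω_v = [j,k)`. -/
def Canonical (G : RegGraph V ρ) (K : Param V) : Prop :=
  ∀ v : V, ∀ ω ∈ Context G v, (ω v).1 - 1 ≤ K v ω ∧ K v ω ≤ (ω v).2

/-- The canonization of a parametrization. -/
noncomputable def CanP (K : Param V) : Param V := fun v ω =>
  if K v ω + 1 < (ω v).1 then (ω v).1 - 1
  else if (ω v).2 < K v ω then (ω v).2
  else K v ω

/-- A regulatory graph is complete iff it contains every possible edge. -/
def Complete (G : RegGraph V ρ) : Prop :=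
  ∀ u v : V, ∀ n : ℕ, 1 ≤ n → n ≤ ρ u → (u, n, v) ∈ G.E

/-- The finite set of all possible edges for activity levels `ρ`. -/
def allEdges (ρ : V → ℕ) : Finset (V × ℕ × V) :=
  Finset.filter (fun e => 1 ≤ e.2.1 ∧ e.2.1 ≤ ρ e.1)
    (Finset.univ ×ˢ (Finset.Icc 1 (Finset.univ.sup ρ)) ×ˢ Finset.univ)

/-- `n_−`: the largest element of `Θ(u,v)` strictly below `n`. -/
noncomputable def nminus (G : RegGraph V ρ) (u v : V) (n : ℕ) : ℕ :=
  sSup {m | m ∈ Theta G u v ∧ m < n}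

/-- `n_+`: the smallest element of `Θ(u,v)` strictly above `n`. -/
noncomputable def nplus (G : RegGraph V ρ) (u v : V) (n : ℕ) : ℕ :=
  sInf {m | m ∈ Theta G u v ∧ n < m}

/-- The parametrization accompanying the completion by the edge `e = (u, n, v)`:
the two contexts obtained by splitting a context of `G` at `n` both inherit the
original value. (`n_−, n_+` are taken w.r.t. the graph `G` before insertion.) -/
noncomputable def CompParam (G : RegGraph V ρ) (K : Param V) (e : V × ℕ × V) : Param V :=
  fun w ω =>
    if w = e.2.2 ∧ (ω e.1 = (nminus G e.1 e.2.2 e.2.1, e.2.1) ∨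
                    ω e.1 = (e.2.1, nplus G e.1 e.2.2 e.2.1))
    then K e.2.2 (Function.update ω e.1 (nminus G e.1 e.2.2 e.2.1, nplus G e.1 e.2.2 e.2.1))
    else K w ω

/-- One completion step: add the least missing edge (w.r.t. the fixed total
order) and extend the parametrization conservatively; complete graphs are fixed. -/
noncomputable def Comp [LinearOrder (V × ℕ × V)] (P : RegGraph V ρ × Param V) :
    RegGraph V ρ × Param V :=
  if h : ((allEdges ρ) \ P.1.E).Nonempty then
    (⟨insert (((allEdges ρ) \ P.1.E).min' h) P.1.E, by
        intro e' he'
        rcases Finset.mem_insert.mp he' with h1 | h1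
        · have hmem := Finset.min'_mem ((allEdges ρ) \ P.1.E) h
          have hall : ((allEdges ρ) \ P.1.E).min' h ∈ allEdges ρ :=
            (Finset.mem_sdiff.mp hmem).1
          rw [h1]
          exact (Finset.mem_filter.mp hall).2
        · exact P.1.valid e' h1⟩,
      CompParam P.1 P.2 (((allEdges ρ) \ P.1.E).min' h))
  else P

/-- `P` is a fixed point of `f` reached by iterating `f` from `start`. -/
def IsFixReached {α : Type*} (f : α → α) (start P : α) : Prop :=
  (∃ n : ℕ, f^[n] start = P) ∧ f P = P

/-- Equality of parametrized regulatory graphs: the graphs coincide and the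
parametrizations agree on all regulatory contexts. -/
def PGEq (A B : RegGraph V ρ × Param V) : Prop :=
  A.1 = B.1 ∧ ∀ v : V, ∀ ω ∈ Context A.1 v, A.2 v ω = B.2 v ω

/-- Replacing the value of `K` at component `v` and context `ω` by `j'`. -/
noncomputable def replaceAt (K : Param V) (v : V) (ω : V → ℕ × ℕ) (j' : ℕ) : Param V :=
  fun w ω' => if w = v ∧ ω' = ω then j' else K w ω'

/-- The edge `e = (u,n,v)` is not observable in the parametrization `K`. -/
def NotObsParam (G : RegGraph V ρ) (K : Param V) (e : V × ℕ × V) : Prop :=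
  ∀ ω ∈ Context G e.2.2, ω e.1 = (e.2.1, nplus G e.1 e.2.2 e.2.1) →
    K e.2.2 ω = K e.2.2 (Function.update ω e.1 (nminus G e.1 e.2.2 e.2.1, e.2.1))

/-- The edge `e = (u,n,v)` is not observable in the transition system `T_G(K)`. -/
def NotObsTS (G : RegGraph V ρ) (K : Param V) (e : V × ℕ × V) : Prop :=
  ∀ s ∈ States ρ, nminus G e.1 e.2.2 e.2.1 ≤ s e.1 → s e.1 < nplus G e.1 e.2.2 e.2.1 →
    ∃ k ≤ ρ e.2.2, ∀ j : ℕ, nminus G e.1 e.2.2 e.2.1 ≤ j → j < nplus G e.1 e.2.2 e.2.1 →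
      delta G K e.2.2 (Function.update s e.1 j) =
        Int.sign ((k : ℤ) - ((Function.update s e.1 j) e.2.2 : ℤ))

/-- The monotone target value `(F^K_v)^{mon}(s)`. -/
noncomputable def mon (G : RegGraph V ρ) (K : Param V) (v : V) (s : V → ℕ) : ℕ :=
  if delta G K v s = 0 then s v
  else if delta G K v s = 1 then
    sInf {j | s v < j ∧ delta G K v (Function.update s v j) ≠ 1}
  else
    sSup {j | j < s v ∧ delta G K v (Function.update s v j) ≠ -1}

/-- Non-observability of `e = (u,n,v)` in `T_G(K)` phrased via monotone target values. -/
def NotObsTSmon (G : RegGraph V ρ) (K : Param V) (e : V × ℕ × V) : Prop :=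
  ∀ s ∈ States ρ, nminus G e.1 e.2.2 e.2.1 ≤ s e.1 → s e.1 < nplus G e.1 e.2.2 e.2.1 →
    ∀ j : ℕ, nminus G e.1 e.2.2 e.2.1 ≤ j → j < nplus G e.1 e.2.2 e.2.1 →
      delta G K e.2.2 (Function.update s e.1 j) =
        Int.sign ((mon G K e.2.2 s : ℤ) - ((Function.update s e.1 j) e.2.2 : ℤ))

/-- In the normalization algorithm: the context below the current one
(the `v`-interval is replaced by its predecessor interval `[n_{i−1}, n_i)`). -/
noncomputable def updLow (G : RegGraph V ρ) (v : V) (ω : V → ℕ × ℕ) : V → ℕ × ℕ :=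
  Function.update ω v (sSup {m | m ∈ Theta G v v ∧ m < (ω v).1}, (ω v).1)

/-- In the normalization algorithm: the context above the current one
(the `v`-interval is replaced by its successor interval `[n_{i+1}, n_{i+2})`). -/
noncomputable def updHigh (G : RegGraph V ρ) (v : V) (ω : V → ℕ × ℕ) : V → ℕ × ℕ :=
  Function.update ω v ((ω v).2, sInf {m | m ∈ Theta G v v ∧ (ω v).2 < m})

/-- The recursive normalization algorithm `Norm(K, v, ω)` of the paper, as an
inductive big-step relation: `NormRel G K v ω r` holds iff the recursion
started at `ω` terminates with result `r`. -/
inductive NormRel (G : RegGraph V ρ) (K : Param V) (v : V) : (V → ℕ × ℕ) → ℕ → Prop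
  | inside (ω : V → ℕ × ℕ) (h1 : (ω v).1 ≤ K v ω) (h2 : K v ω < (ω v).2) :
      NormRel G K v ω (K v ω)
  | belowStop (ω : V → ℕ × ℕ) (h : K v ω < (ω v).1)
      (h2 : (ω v).1 - 1 ≤ K v (updLow G v ω)) :
      NormRel G K v ω ((ω v).1 - 1)
  | belowRec (ω : V → ℕ × ℕ) (r : ℕ) (h : K v ω < (ω v).1)
      (h2 : K v (updLow G v ω) < (ω v).1 - 1)
      (hrec : NormRel G K v (updLow G v ω) r) :
      NormRel G K v ω r
  | aboveStop (ω : V → ℕ × ℕ) (h : (ω v).2 ≤ K v ω)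
      (h2 : K v (updHigh G v ω) ≤ (ω v).2) :
      NormRel G K v ω ((ω v).2)
  | aboveRec (ω : V → ℕ × ℕ) (r : ℕ) (h : (ω v).2 ≤ K v ω)
      (h2 : (ω v).2 < K v (updHigh G v ω))
      (hrec : NormRel G K v (updHigh G v ω) r) :
      NormRel G K v ω r

/-- The normalized parametrization: each context gets the common monotone
target value of its states (represented by the lower corner of the context). -/
noncomputable def NormPm (G : RegGraph V ρ) (K : Param V) : Param V :=
  fun v ω => mon G K v (fun u => (ω u).1)

/-- The edges of `G` that are not observable in `N`. -/
noncomputable def nonObsEdges (G : RegGraph V ρ) (N : Param V) : Finset (V × ℕ × V) :=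
  G.E.filter (fun e => NotObsParam G N e)

/-- The parametrization accompanying the removal of the non-observable edge
`e = (u,n,v)`: the two contexts merged into one pass on their common value. -/
noncomputable def MinParam (G : RegGraph V ρ) (N : Param V) (e : V × ℕ × V) : Param V :=
  fun w ω =>
    if w = e.2.2 ∧ ω e.1 = (nminus G e.1 e.2.2 e.2.1, nplus G e.1 e.2.2 e.2.1)
    then N e.2.2 (Function.update ω e.1 (nminus G e.1 e.2.2 e.2.1, e.2.1))
    else N w ω

/-- One minimization step: remove the least edge (w.r.t. the fixed total order)
that is not observable in `N`; if all edges are observable, do nothing. -/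
noncomputable def Minim [LinearOrder (V × ℕ × V)] (P : RegGraph V ρ × Param V) :
    RegGraph V ρ × Param V :=
  if h : (nonObsEdges P.1 P.2).Nonempty then
    (⟨P.1.E.erase ((nonObsEdges P.1 P.2).min' h),
        fun e' he' => P.1.valid e' (Finset.mem_of_mem_erase he')⟩,
      MinParam P.1 P.2 ((nonObsEdges P.1 P.2).min' h))
  else P


theorem aux_low (G : RegGraph V ρ) (u v : V) (m : ℕ) (hm : 0 < m) :
    sSup {l | l ∈ Theta G u v ∧ l < m} ∈ Theta G u v ∧
    sSup {l | l ∈ Theta G u v ∧ l < m} < m ∧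
    ∀ l ∈ Theta G u v, l < m → l ≤ sSup {l | l ∈ Theta G u v ∧ l < m} := by
  have hb : BddAbove {l | l ∈ Theta G u v ∧ l < m} := ⟨m, fun l hl => hl.2.le⟩
  have hne : {l | l ∈ Theta G u v ∧ l < m}.Nonempty := ⟨0, by simp [Theta], hm⟩
  have h1 := Nat.sSup_mem hne hb
  exact ⟨h1.1, h1.2, fun l hl hlm => le_csSup hb ⟨hl, hlm⟩⟩

theorem aux_high (G : RegGraph V ρ) (u v : V) (m : ℕ) (hm : m ≤ ρ u) :
    sInf {l | l ∈ Theta G u v ∧ m < l} ∈ Theta G u v ∧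
    m < sInf {l | l ∈ Theta G u v ∧ m < l} ∧
    ∀ l ∈ Theta G u v, m < l → sInf {l | l ∈ Theta G u v ∧ m < l} ≤ l := by
  have hne : {l | l ∈ Theta G u v ∧ m < l}.Nonempty :=
    ⟨ρ u + 1, by simp [Theta], Nat.lt_succ_of_le hm⟩
  have h1 := Nat.sInf_mem hne
  exact ⟨h1.1, h1.2, fun l hl hlm => Nat.sInf_le ⟨hl, hlm⟩⟩

theorem theta_le (G : RegGraph V ρ) (u v : V) (m : ℕ) (hm : m ∈ Theta G u v) :
    m ≤ ρ u + 1 := by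
  rcases hm with hm | hm | hm
  · have := (G.valid _ hm).2
    simp only at this
    omega
  · omega
  · have : m = ρ u + 1 := hm
    omega

theorem low_int (G : RegGraph V ρ) (u v : V) (m : ℕ) (hmT : m ∈ Theta G u v) (hm : 0 < m) :
    (sSup {l | l ∈ Theta G u v ∧ l < m}, m) ∈ ActInterval G u v := by
  obtain ⟨h1, h2, h3⟩ := aux_low G u v m hm
  refine ⟨h1, hmT, h2, fun l hl hc => ?_⟩
  have := h3 l hl hc.2
  have := hc.1
  simp only at this
  omega

theorem high_int (G : RegGraph V ρ) (u v : V) (m : ℕ) (hmT : m ∈ Theta G u v) (hm : m ≤ ρ u) :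
    (m, sInf {l | l ∈ Theta G u v ∧ m < l}) ∈ ActInterval G u v := by
  obtain ⟨h1, h2, h3⟩ := aux_high G u v m hm
  refine ⟨hmT, h1, h2, fun l hl hc => ?_⟩
  have := h3 l hl hc.1
  have := hc.2
  simp only at this
  omega

theorem ctx_update (G : RegGraph V ρ) (u v : V) (ω : V → ℕ × ℕ) (hω : ω ∈ Context G v)
    (p : ℕ × ℕ) (hp : p ∈ ActInterval G u v) : Function.update ω u p ∈ Context G v := by
  intro w
  by_cases hw : w = u
  · subst hw; simpa using hp
  · simpa [hw] using hω w

theorem ctxOf_eq (G : RegGraph V ρ) (v : V) (ω : V → ℕ × ℕ) (hω : ω ∈ Context G v)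
    (s : V → ℕ) (hs : memCtx ω s) : ctxOf G v s = ω := by
  funext u
  obtain ⟨h1, h2, h3, h4⟩ := hω u
  obtain ⟨h5, h6⟩ := hs u
  have hb : BddAbove {m | m ∈ Theta G u v ∧ m ≤ s u} := ⟨s u, fun l hl => hl.2⟩
  have a := Nat.sSup_mem (s := {m | m ∈ Theta G u v ∧ m ≤ s u}) ⟨(ω u).1, h1, h5⟩ hb
  have b : (ω u).1 ≤ sSup {m | m ∈ Theta G u v ∧ m ≤ s u} := le_csSup hb ⟨h1, h5⟩
  have c := Nat.sInf_mem (s := {m | m ∈ Theta G u v ∧ s u < m}) ⟨(ω u).2, h2, h6⟩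
  have d : sInf {m | m ∈ Theta G u v ∧ s u < m} ≤ (ω u).2 := Nat.sInf_le ⟨h2, h6⟩
  have e1 := h4 _ a.1
  have e2 := h4 _ c.1
  have a2 := a.2
  have c2 := c.2
  apply Prod.ext
  · show sSup {m | m ∈ Theta G u v ∧ m ≤ s u} = _
    omega
  · show sInf {m | m ∈ Theta G u v ∧ s u < m} = _
    omega

theorem delta_eq (G : RegGraph V ρ) (K : Param V) (v : V) (ω : V → ℕ × ℕ)
    (hω : ω ∈ Context G v) (s : V → ℕ) (hs : memCtx ω s) :
    delta G K v s = Int.sign ((K v ω : ℤ) - s v) := by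
  unfold delta F
  rw [ctxOf_eq G v ω hω s hs]
  split_ifs with h1 h2
  · rw [Int.sign_eq_one_of_pos (by omega)]; push_cast; ring
  · rw [h2]; simp
  · rw [Int.sign_eq_neg_one_of_neg (by omega)]; omega

theorem sign_cmp {a b : ℤ} (h : Int.sign a = Int.sign b) :
    (0 < a ↔ 0 < b) ∧ (a < 0 ↔ b < 0) := by
  rw [← Int.sign_eq_one_iff_pos, ← Int.sign_eq_one_iff_pos, ← Int.sign_eq_neg_one_iff_neg,
    ← Int.sign_eq_neg_one_iff_neg, h]
  simp

/-- Comparison principle: two contexts have the same sign behaviour. -/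
def Same (K : Param V) (v : V) (ω ω' : V → ℕ × ℕ) : Prop :=
  ω v = ω' v ∧ ∀ x : ℕ, (ω v).1 ≤ x → x < (ω v).2 →
    ((x < K v ω ↔ x < K v ω') ∧ (K v ω < x ↔ K v ω' < x))

/-- Generic determinism along a relation preserved by the recursive steps. -/
theorem norm_det (G : RegGraph V ρ) (K : Param V) (hK : IsParam G K) (v : V)
    (R : (V → ℕ × ℕ) → (V → ℕ × ℕ) → Prop)
    (hR : ∀ ω ω', R ω ω' → ω ∈ Context G v ∧ Same K v ω ω')
    (hlow : ∀ ω ω', R ω ω' → 0 < (ω v).1 → R (updLow G v ω) (updLow G v ω'))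
    (hhigh : ∀ ω ω', R ω ω' → (ω v).2 ≤ ρ v → R (updHigh G v ω) (updHigh G v ω'))
    (ω : V → ℕ × ℕ) (r : ℕ) (h : NormRel G K v ω r) :
    ∀ ω' r', R ω ω' → NormRel G K v ω' r' → r = r' := by
  have key : ∀ ω ω', R ω ω' → K v ω ≤ ρ v ∧ ω v = ω' v ∧ (ω v).1 < (ω v).2 ∧
      ∀ x : ℕ, (ω v).1 ≤ x → x < (ω v).2 →
      ((x < K v ω ↔ x < K v ω') ∧ (K v ω < x ↔ K v ω' < x)) := by
    intro ω ω' hr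
    obtain ⟨hc, h1, h2⟩ := hR _ _ hr
    exact ⟨hK v ω hc, h1, (hc v).2.2.1, h2⟩
  have L : ∀ ω ω', R ω ω' → K v ω < (ω v).1 → R (updLow G v ω) (updLow G v ω') ∧
      (K v (updLow G v ω) < (ω v).1 - 1 ↔ K v (updLow G v ω') < (ω v).1 - 1) := by
    intro ω ω' hr hlt
    have h0 : 0 < (ω v).1 := by omega
    have hr' := hlow _ _ hr h0
    refine ⟨hr', ?_⟩
    obtain ⟨_, _, h3, h4⟩ := key _ _ hr'
    have e1 : (updLow G v ω v).2 = (ω v).1 := by simp [updLow]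
    exact (h4 ((ω v).1 - 1) (by omega) (by omega)).2
  have H : ∀ ω ω', R ω ω' → (ω v).2 ≤ K v ω → R (updHigh G v ω) (updHigh G v ω') ∧
      ((ω v).2 < K v (updHigh G v ω) ↔ (ω v).2 < K v (updHigh G v ω')) := by
    intro ω ω' hr hlt
    have h0 : (ω v).2 ≤ ρ v := hlt.trans (key _ _ hr).1
    have hr' := hhigh _ _ hr h0
    refine ⟨hr', ?_⟩
    obtain ⟨_, _, h3, h4⟩ := key _ _ hr'
    have e1 : (updHigh G v ω v).1 = (ω v).2 := by simp [updHigh]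
    exact (h4 ((ω v).2) (by omega) (by omega)).1
  induction h with
  | inside ω h1 h2 =>
    intro ω' r' hr h'
    obtain ⟨k1, k2, k3, k4⟩ := key _ _ hr
    have q := k4 (K v ω) h1 h2
    cases h' with
    | inside _ => omega
    | belowStop _ a b => rw [← k2] at a; omega
    | belowRec _ _ a b => rw [← k2] at a; omega
    | aboveStop _ a b => rw [← k2] at a; omega
    | aboveRec _ _ a b => rw [← k2] at a; omega
  | belowStop ω a b =>
    intro ω' r' hr h'
    obtain ⟨k1, k2, k3, k4⟩ := key _ _ hr
    have q := k4 (ω v).1 (by omega) (by omega)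
    have l := L _ _ hr a
    cases h' with
    | inside h1 h2 => rw [← k2] at *; omega
    | belowStop _ a b => rw [← k2]
    | belowRec _ _ a b => rw [← k2] at *; omega
    | aboveStop a b => rw [← k2] at *; omega
    | aboveRec _ _ a b => rw [← k2] at *; omega
  | belowRec ω r a b hrec ih =>
    intro ω' r' hr h'
    obtain ⟨k1, k2, k3, k4⟩ := key _ _ hr
    have q := k4 (ω v).1 (by omega) (by omega)
    have l := L _ _ hr a
    cases h' with
    | inside h1 h2 => rw [← k2] at *; omega
    | belowStop a b => rw [← k2] at *; omega
    | belowRec _ _ a b c => exact ih _ _ l.1 c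
    | aboveStop a b => rw [← k2] at *; omega
    | aboveRec _ _ a b => rw [← k2] at *; omega
  | aboveStop ω a b =>
    intro ω' r' hr h'
    obtain ⟨k1, k2, k3, k4⟩ := key _ _ hr
    have q := k4 ((ω v).2 - 1) (by omega) (by omega)
    have l := H _ _ hr a
    cases h' with
    | inside h1 h2 => rw [← k2] at *; omega
    | belowStop a b => rw [← k2] at *; omega
    | belowRec _ _ a b c => rw [← k2] at *; omega
    | aboveStop a b => rw [← k2]
    | aboveRec _ _ a b => rw [← k2] at *; omega
  | aboveRec ω r a b hrec ih =>
    intro ω' r' hr h'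
    obtain ⟨k1, k2, k3, k4⟩ := key _ _ hr
    have q := k4 ((ω v).2 - 1) (by omega) (by omega)
    have l := H _ _ hr a
    cases h' with
    | inside h1 h2 => rw [← k2] at *; omega
    | belowStop a b => rw [← k2] at *; omega
    | belowRec _ _ a b c => rw [← k2] at *; omega
    | aboveStop a b => rw [← k2] at *; omega
    | aboveRec _ _ a b c => exact ih _ _ l.1 c

theorem updLow_ctx (G : RegGraph V ρ) (v : V) (ω : V → ℕ × ℕ) (hω : ω ∈ Context G v)
    (h : 0 < (ω v).1) : updLow G v ω ∈ Context G v :=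
  ctx_update G v v ω hω _ (low_int G v v _ (hω v).1 h)

theorem updHigh_ctx (G : RegGraph V ρ) (v : V) (ω : V → ℕ × ℕ) (hω : ω ∈ Context G v)
    (h : (ω v).2 ≤ ρ v) : updHigh G v ω ∈ Context G v :=
  ctx_update G v v ω hω _ (high_int G v v _ (hω v).2.1 h)

theorem norm_unique (G : RegGraph V ρ) (K : Param V) (hK : IsParam G K) (v : V)
    (ω : V → ℕ × ℕ) (hω : ω ∈ Context G v) (r r' : ℕ) (h : NormRel G K v ω r)
    (h' : NormRel G K v ω r') : r = r' := by
  refine norm_det G K hK v (fun a b => a = b ∧ a ∈ Context G v) ?_ ?_ ?_ ω r h ω r' ⟨rfl, hω⟩ h'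
  · rintro a _ ⟨rfl, ha⟩
    exact ⟨ha, rfl, fun _ _ _ => ⟨Iff.rfl, Iff.rfl⟩⟩
  · rintro a _ ⟨rfl, ha⟩ h0
    exact ⟨rfl, updLow_ctx G v a ha h0⟩
  · rintro a _ ⟨rfl, ha⟩ h0
    exact ⟨rfl, updHigh_ctx G v a ha h0⟩

theorem mem_states (G : RegGraph V ρ) (v : V) (ω : V → ℕ × ℕ) (hω : ω ∈ Context G v)
    (s : V → ℕ) (hs : memCtx ω s) : s ∈ States ρ := by
  intro u
  have := theta_le G u v _ (hω u).2.1
  have := (hs u).2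
  omega

theorem mem_upd (ω : V → ℕ × ℕ) (s : V → ℕ) (hs : memCtx ω s) (u : V) (p : ℕ × ℕ) (j : ℕ)
    (h1 : p.1 ≤ j) (h2 : j < p.2) : memCtx (Function.update ω u p) (Function.update s u j) := by
  intro w
  by_cases hw : w = u
  · subst hw; simp [h1, h2]
  · simpa [hw] using hs w

theorem mem_low (G : RegGraph V ρ) (v : V) (ω : V → ℕ × ℕ) (hω : ω ∈ Context G v) :
    memCtx ω (fun w => (ω w).1) := fun w => ⟨le_rfl, (hω w).2.2.1⟩

/-- Every edge that is not observable in the transition system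
`T_G(K)` is not observable in the normalized parametrization `N`. -/
theorem normalized_detects_unobservable {V : Type*} [DecidableEq V] [Fintype V]
    {ρ : V → ℕ} (hρ : ∀ v, 1 ≤ ρ v) (G : RegGraph V ρ)
    (K : Param V) (hK : IsParam G K)
    (N : Param V) (hN : ∀ v : V, ∀ ω ∈ Context G v, NormRel G K v ω (N v ω))
    (e : V × ℕ × V) (he : e ∈ G.E) (h : NotObsTS G K e) :
    NotObsParam G N e := by
  obtain ⟨u, n, v⟩ := e
  obtain ⟨hn1, hn2⟩ := G.valid _ he
  simp only at hn1 hn2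
  have hnT : n ∈ Theta G u v := Or.inl he
  obtain ⟨hl1, hl2, -⟩ := aux_low G u v n hn1
  obtain ⟨hh1, hh2, -⟩ := aux_high G u v n hn2
  have hmi := low_int G u v n hnT hn1
  have hpi := high_int G u v n hnT hn2
  change nminus G u v n < n at hl2
  change n < nplus G u v n at hh2
  change (nminus G u v n, n) ∈ _ at hmi
  change (n, nplus G u v n) ∈ _ at hpi
  clear hl1 hh1
  intro ω hω hωu
  simp only at hω hωu ⊢
  have hω' := ctx_update G u v ω hω _ hmi
  have A := hN v ω hω
  have B := hN v _ hω'
  unfold NotObsTS at h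
  simp only at h
  generalize hlo : nminus G u v n = lo at *
  generalize hhi : nplus G u v n = hi at *
  by_cases huv : u = v
  · subst huv
    obtain ⟨k, -, hk⟩ := h _ (mem_states G u ω hω _ (mem_low G u ω hω))
      (by simp [hωu]; omega) (by simp [hωu]; omega)
    have k1 : ∀ j, n ≤ j → j < hi →
        ((j < K u ω ↔ j < k) ∧ (K u ω < j ↔ k < j)) := by
      intro j h1 h2
      have m := mem_upd ω _ (mem_low G u ω hω) u (n, hi) j h1 h2
      rw [← hωu, Function.update_eq_self] at m
      have q := hk j (by omega) h2
      rw [delta_eq G K u ω hω _ m] at q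
      have := sign_cmp q
      simp only [Function.update_self] at this
      omega
    have k2 : ∀ j, lo ≤ j → j < n →
        ((j < K u (Function.update ω u (lo, n)) ↔ j < k) ∧
          (K u (Function.update ω u (lo, n)) < j ↔ k < j)) := by
      intro j h1 h2
      have m := mem_upd ω _ (mem_low G u ω hω) u (lo, n) j h1 h2
      have q := hk j (by omega) (by omega)
      rw [delta_eq G K u _ hω' _ m] at q
      have := sign_cmp q
      simp only [Function.update_self] at this
      omega
    have eL : updLow G u ω = Function.update ω u (lo, n) := by
      unfold updLow
      rw [hωu]
      simp only
      rw [← hlo]; rfl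
    have eH : updHigh G u (Function.update ω u (lo, n)) = ω := by
      unfold updHigh
      simp only [Function.update_self, Function.update_idem]
      change Function.update ω u (n, nplus G u u n) = ω
      rw [hhi, ← hωu, Function.update_eq_self]
    generalize hw : Function.update ω u (lo, n) = ω' at *
    have e' : ω' u = (lo, n) := by rw [← hw]; simp
    clear hw
    have a1 := k1 n le_rfl hh2
    have a2 := k1 (hi - 1) (by omega) (by omega)
    have b1 := k2 lo le_rfl hl2
    have b2 := k2 (n - 1) (by omega) (by omega)
    by_cases hkn : k < n
    · have hKlt : K u ω < n := by omega
      by_cases hst : K u ω' < n - 1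
      · refine norm_unique G K hK u ω hω _ _ A (NormRel.belowRec ω _ ?_ ?_ ?_)
        · rw [hωu]; exact hKlt
        · rw [eL, hωu]; exact hst
        · rw [eL]; exact B
      · have a : N u ω = n - 1 := by
          have := NormRel.belowStop (G := G) (K := K) (v := u) ω (by rw [hωu]; exact hKlt)
            (by rw [eL, hωu]; simp only; omega)
          rw [hωu] at this
          exact norm_unique G K hK u ω hω _ _ A this
        have b : N u ω' = K u ω' := norm_unique G K hK u ω' hω' _ _ B
          (NormRel.inside ω' (by rw [e']; simp only; omega) (by rw [e']; simp only; omega))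
        omega
    · have hKge : n ≤ K u ω' := by omega
      by_cases hst : n < K u ω
      · refine (norm_unique G K hK u ω' hω' _ _ B (NormRel.aboveRec ω' _ ?_ ?_ ?_)).symm
        · rw [e']; exact hKge
        · rw [eH, e']; exact hst
        · rw [eH]; exact A
      · have a : N u ω' = n := by
          have := NormRel.aboveStop (G := G) (K := K) (v := u) ω' (by rw [e']; exact hKge)
            (by rw [eH, e']; simp only; omega)
          rw [e'] at this
          exact norm_unique G K hK u ω' hω' _ _ B this
        have b : N u ω = K u ω := norm_unique G K hK u ω hω _ _ A
          (NormRel.inside ω (by rw [hωu]; simp only; omega) (by rw [hωu]; simp only; omega))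
        omega
  · have hvu : v ≠ u := fun hh => huv hh.symm
    refine norm_det G K hK v (fun a b => a ∈ Context G v ∧ a u = (n, hi) ∧
      b = Function.update a u (lo, n)) ?_ ?_ ?_ ω _ A _ _ ⟨hω, hωu, rfl⟩ B
    · rintro a _ ⟨ha, hau, rfl⟩
      refine ⟨ha, by simp [hvu], fun x hx1 hx2 => ?_⟩
      have m0 := mem_upd a _ (mem_low G v a ha) v (a v) x hx1 hx2
      rw [Function.update_eq_self] at m0
      set s := Function.update (fun w => (a w).1) v x with hs
      have su : s u = n := by simp [hs, huv, hau]
      have sv : s v = x := by simp [hs]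
      obtain ⟨k, -, hk⟩ := h s (mem_states G v a ha _ m0) (by omega) (by omega)
      have q1 := hk n (by omega) (by omega)
      have q2 := hk lo (by omega) (by omega)
      have m1 := mem_upd a s m0 u (n, hi) n le_rfl hh2
      rw [← hau, Function.update_eq_self] at m1
      have m2 := mem_upd a s m0 u (lo, n) lo le_rfl hl2
      rw [delta_eq G K v a ha _ m1] at q1
      rw [delta_eq G K v _ (ctx_update G u v a ha _ hmi) _ m2] at q2
      have c1 := sign_cmp q1
      have c2 := sign_cmp q2
      simp only [Function.update_of_ne hvu, sv] at c1 c2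
      omega
    · rintro a _ ⟨ha, hau, rfl⟩ h0
      refine ⟨updLow_ctx G v a ha h0, by simp [updLow, huv, hau], ?_⟩
      unfold updLow
      rw [Function.update_of_ne hvu, Function.update_comm hvu]
    · rintro a _ ⟨ha, hau, rfl⟩ h0
      refine ⟨updHigh_ctx G v a ha h0, by simp [updHigh, huv, hau], ?_⟩
      unfold updHigh
      rw [Function.update_of_ne hvu, Function.update_comm hvu]

end MVReg
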